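/- Let P be a Markov operator on L¹(X,m). Suppose there exists a measurable function u : X → [0,∞] with u > 0 a.e. that is properly subinvariant, i.e., there is a sequence (fₖ) of nonnegative functions in L¹(X,m) increasing pointwise a.e. to u such that the a.e. pointwise limit P u of P fₖ satisfies P u < u a.e. Then P is dissipative: for every w ∈ L¹(X,m) with w > 0 a.e., the sum Σ_{k=0}^∞ (Pᵏw)(x) is finite for m-almost every x ∈ X. -/

import Mathlib

open MeasureTheory Filter Topology ENNReal

/-- A Markov operator on `L¹(X,m)`, represented by a linear operator on (representatives of)
functions: it maps integrable functions to integrable functions, is positive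
(`f ≥ 0` a.e. implies `P f ≥ 0` a.e.) and is an `L¹`-contraction. -/
def IsMarkovOperator {X : Type*} [MeasurableSpace X] (m : Measure X)
    (P : (X → ℝ) →ₗ[ℝ] (X → ℝ)) : Prop :=
  (∀ f : X → ℝ, Integrable f m → Integrable (P f) m) ∧
  (∀ f : X → ℝ, Integrable f m → 0 ≤ᵐ[m] f → 0 ≤ᵐ[m] P f) ∧
  (∀ f : X → ℝ, Integrable f m → ∫ x, |P f x| ∂m ≤ ∫ x, |f x| ∂m)

/-- `u : X → [0,∞]` is properly subinvariant for `P`: there is a sequence `(fₖ)` of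
nonnegative `L¹` functions increasing pointwise a.e. to `u` such that the a.e. pointwise
limit `Pu` of `P fₖ` (the extension of `P` to `u`) satisfies `Pu < u` a.e. -/
def ProperlySubinvariant {X : Type*} [MeasurableSpace X] (m : Measure X)
    (P : (X → ℝ) →ₗ[ℝ] (X → ℝ)) (u : X → ℝ≥0∞) : Prop :=
  ∃ f : ℕ → X → ℝ,
    (∀ k, Integrable (f k) m) ∧ (∀ k, 0 ≤ᵐ[m] f k) ∧
    (∀ᵐ x ∂m, Monotone fun k => f k x) ∧
    (∀ᵐ x ∂m, Filter.Tendsto (fun k => ENNReal.ofReal (f k x)) atTop (𝓝 (u x))) ∧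
    ∃ Pu : X → ℝ≥0∞,
      (∀ᵐ x ∂m, Filter.Tendsto (fun k => ENNReal.ofReal (P (f k) x)) atTop (𝓝 (Pu x))) ∧
      (∀ᵐ x ∂m, Pu x < u x)

namespace IsMarkovOperator

variable {X : Type*} [MeasurableSpace X] {m : Measure X} {P : (X → ℝ) →ₗ[ℝ] (X → ℝ)}

theorem ae_le (hP : IsMarkovOperator m P) {f g : X → ℝ} (hf : Integrable f m)
    (hg : Integrable g m) (hfg : f ≤ᵐ[m] g) : P f ≤ᵐ[m] P g := by
  have h := hP.2.1 (g - f) (hg.sub hf) (by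
    filter_upwards [hfg] with x hx
    simpa using hx)
  rw [map_sub] at h
  filter_upwards [h] with x hx
  simpa using hx

theorem integrable_pow (hP : IsMarkovOperator m P) {f : X → ℝ} (hf : Integrable f m) (k : ℕ) :
    Integrable ((P ^ k) f) m := by
  induction k with
  | zero => simpa using hf
  | succ k ih => simpa [pow_succ'] using hP.1 _ ih

theorem pow_nonneg (hP : IsMarkovOperator m P) {f : X → ℝ} (hf : Integrable f m)
    (h0 : 0 ≤ᵐ[m] f) (k : ℕ) : 0 ≤ᵐ[m] (P ^ k) f := by
  induction k with
  | zero => simpa using h0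
  | succ k ih => simpa [pow_succ'] using hP.2.1 _ (hP.integrable_pow hf k) ih

theorem lintegral_enorm_le (hP : IsMarkovOperator m P) {f : X → ℝ} (hf : Integrable f m) :
    ∫⁻ x, ‖P f x‖ₑ ∂m ≤ ∫⁻ x, ‖f x‖ₑ ∂m := by
  rw [← ofReal_integral_norm_eq_lintegral_enorm hf,
    ← ofReal_integral_norm_eq_lintegral_enorm (hP.1 f hf)]
  exact ENNReal.ofReal_le_ofReal (hP.2.2 f hf)

theorem integral_le (hP : IsMarkovOperator m P) {f : X → ℝ} (hf : Integrable f m)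
    (h0 : 0 ≤ᵐ[m] f) : ∫ x, P f x ∂m ≤ ∫ x, f x ∂m := by
  calc ∫ x, P f x ∂m ≤ ∫ x, |P f x| ∂m :=
        integral_mono (hP.1 f hf) (hP.1 f hf).abs fun x => le_abs_self _
    _ ≤ ∫ x, |f x| ∂m := hP.2.2 f hf
    _ = ∫ x, f x ∂m := integral_congr_ae (by
        filter_upwards [h0] with x hx
        exact abs_of_nonneg hx)

/-- The extension of `P` to `[0,∞]`-valued functions dominates `P` on smaller `L¹` functions. -/
theorem ofReal_le_of_tendsto (hP : IsMarkovOperator m P) {f : ℕ → X → ℝ} {φ : X → ℝ}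
    {u Pu : X → ℝ≥0∞} (hf : ∀ k, Integrable (f k) m) (hf0 : ∀ k, 0 ≤ᵐ[m] f k)
    (hfu : ∀ᵐ x ∂m, Tendsto (fun k => ENNReal.ofReal (f k x)) atTop (𝓝 (u x)))
    (hPu : ∀ᵐ x ∂m, Tendsto (fun k => ENNReal.ofReal (P (f k) x)) atTop (𝓝 (Pu x)))
    (hφ : Integrable φ m) (hφu : ∀ᵐ x ∂m, ENNReal.ofReal (φ x) ≤ u x) :
    ∀ᵐ x ∂m, ENNReal.ofReal (P φ x) ≤ Pu x := by
  let e : ℕ → X → ℝ := fun k x => max (φ x - f k x) 0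
  have he : ∀ k, Integrable (e k) m := fun k => (hφ.sub (hf k)).pos_part
  have henorm : ∀ k x, ‖e k x‖ₑ = ENNReal.ofReal (φ x - f k x) := fun k x => by
    rw [Real.enorm_of_nonneg (le_max_right _ _)]
    simp [ENNReal.ofReal_max]
  have hlim : Tendsto (fun k => ∫⁻ x, ‖e k x‖ₑ ∂m) atTop (𝓝 0) := by
    have := tendsto_lintegral_of_dominated_convergence' (μ := m) (F := fun k x => ‖e k x‖ₑ)
      (f := fun _ => 0) (fun x => ENNReal.ofReal (φ x))
      (fun k => (he k).aestronglyMeasurable.enorm)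
      (fun k => by
        filter_upwards [hf0 k] with x hx
        rw [henorm]
        exact ENNReal.ofReal_le_ofReal (sub_le_self _ hx))
      hφ.lintegral_lt_top.ne
      (by
        filter_upwards [ae_all_iff.2 hf0, hfu, hφu] with x h0 hx hle
        have h := ENNReal.Tendsto.sub (tendsto_const_nhds (x := ENNReal.ofReal (φ x))) hx
          (Or.inl ENNReal.ofReal_ne_top)
        rw [tsub_eq_zero_of_le hle] at h
        refine h.congr fun k => ?_
        rw [henorm, ENNReal.ofReal_sub _ (h0 k)])
    simpa using this
  have hPlim : Tendsto (fun k => eLpNorm (P (e k) - 0) 1 m) atTop (𝓝 0) := by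
    refine tendsto_of_tendsto_of_tendsto_of_le_of_le tendsto_const_nhds hlim
      (fun _ => zero_le) fun k => ?_
    simpa [eLpNorm_one_eq_lintegral_enorm] using hP.lintegral_enorm_le (he k)
  obtain ⟨ns, hns, hae⟩ := (tendstoInMeasure_of_tendsto_eLpNorm one_ne_zero
    (fun k => (hP.1 _ (he k)).aestronglyMeasurable) aestronglyMeasurable_zero
    hPlim).exists_seq_tendsto_ae
  have hle : ∀ k, P φ ≤ᵐ[m] P (f k + e k) := fun k =>
    hP.ae_le hφ ((hf k).add (he k)) (Eventually.of_forall fun x => by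
      have := le_max_left (φ x - f k x) 0
      simp only [Pi.add_apply, e]
      linarith)
  filter_upwards [hae, hPu, ae_all_iff.2 hle] with x hx hx' hxle
  have h1 : Tendsto (fun i => ENNReal.ofReal (P (f (ns i)) x) + ENNReal.ofReal (P (e (ns i)) x))
      atTop (𝓝 (Pu x + 0)) := by
    refine (hx'.comp hns.tendsto_atTop).add ?_
    simpa using ENNReal.tendsto_ofReal hx
  rw [add_zero] at h1
  refine ge_of_tendsto' h1 fun i => ?_
  refine (ENNReal.ofReal_le_ofReal (hxle (ns i))).trans ?_
  rw [map_add]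
  exact ENNReal.ofReal_add_le

end IsMarkovOperator

section MaximalInequality

variable {X : Type*} (P : (X → ℝ) →ₗ[ℝ] (X → ℝ))

/-- The partial sums `h + P h + ⋯ + Pⁿ⁻¹ h`. -/
noncomputable def partialSum (h : X → ℝ) (n : ℕ) : X → ℝ :=
  ∑ k ∈ Finset.range n, (P ^ k) h

theorem partialSum_succ (h : X → ℝ) (n : ℕ) :
    partialSum P h (n + 1) = h + P (partialSum P h n) := by
  simp only [partialSum, Finset.sum_range_succ', map_sum, pow_succ', Module.End.mul_apply,
    pow_zero, Module.End.one_apply]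
  rw [add_comm]

/-- A recursively defined majorant of the partial sums of `h`. -/
noncomputable def hopfMajorant (h : X → ℝ) : ℕ → X → ℝ
  | 0 => 0
  | n + 1 => fun x => max (h x + P (hopfMajorant h n) x) 0

theorem hopfMajorant_nonneg (h : X → ℝ) (n : ℕ) (x : X) : 0 ≤ hopfMajorant P h n x := by
  cases n with
  | zero => exact le_rfl
  | succ n => exact le_max_right _ _

variable {P} [MeasurableSpace X] {m : Measure X}

theorem integrable_partialSum (hP : IsMarkovOperator m P) {h : X → ℝ} (hh : Integrable h m)
    (n : ℕ) : Integrable (partialSum P h n) m :=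
  integrable_finsetSum' _ fun k _ => hP.integrable_pow hh k

theorem integrable_hopfMajorant (hP : IsMarkovOperator m P) {h : X → ℝ} (hh : Integrable h m)
    (n : ℕ) : Integrable (hopfMajorant P h n) m := by
  induction n with
  | zero => exact integrable_zero _ _ _
  | succ n ih => exact (hh.add (hP.1 _ ih)).pos_part

theorem hopfMajorant_mono (hP : IsMarkovOperator m P) {h : X → ℝ} (hh : Integrable h m)
    (n : ℕ) : hopfMajorant P h n ≤ᵐ[m] hopfMajorant P h (n + 1) := by
  induction n with
  | zero => exact Eventually.of_forall fun x => le_max_right _ _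
  | succ n ih =>
    filter_upwards [hP.ae_le (integrable_hopfMajorant hP hh n)
      (integrable_hopfMajorant hP hh (n + 1)) ih] with x hx
    exact max_le_max (by linarith) le_rfl

theorem partialSum_le_hopfMajorant (hP : IsMarkovOperator m P) {h : X → ℝ}
    (hh : Integrable h m) (n : ℕ) : partialSum P h n ≤ᵐ[m] hopfMajorant P h n := by
  induction n with
  | zero => exact Eventually.of_forall fun x => by simp [partialSum, hopfMajorant]
  | succ n ih =>
    filter_upwards [hP.ae_le (integrable_partialSum hP hh n)
      (integrable_hopfMajorant hP hh n) ih] with x hx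
    rw [partialSum_succ]
    exact le_max_of_le_left (by simpa using hx)

theorem nullMeasurableSet_hopfMajorant_pos (hP : IsMarkovOperator m P) {h : X → ℝ}
    (hh : Integrable h m) (n : ℕ) : NullMeasurableSet {x | 0 < hopfMajorant P h n x} m :=
  nullMeasurableSet_lt aemeasurable_const (integrable_hopfMajorant hP hh n).aemeasurable

/-- Hopf's maximal inequality. -/
theorem integral_indicator_hopfMajorant_nonneg (hP : IsMarkovOperator m P) {h : X → ℝ}
    (hh : Integrable h m) (n : ℕ) :
    0 ≤ ∫ x, {x | 0 < hopfMajorant P h n x}.indicator h x ∂m := by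
  cases n with
  | zero => simp [hopfMajorant]
  | succ n =>
    have hM := integrable_hopfMajorant hP hh n
    have hM' := integrable_hopfMajorant hP hh (n + 1)
    have hM0 : 0 ≤ᵐ[m] hopfMajorant P h n :=
      Eventually.of_forall (hopfMajorant_nonneg P h n)
    calc (0 : ℝ) ≤ ∫ x, hopfMajorant P h (n + 1) x ∂m - ∫ x, P (hopfMajorant P h n) x ∂m := by
          have h1 := hP.integral_le hM hM0
          have h2 := integral_mono_ae hM hM' (hopfMajorant_mono hP hh n)
          linarith
      _ = ∫ x, (hopfMajorant P h (n + 1) x - P (hopfMajorant P h n) x) ∂m :=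
          (integral_sub hM' (hP.1 _ hM)).symm
      _ ≤ _ := by
          refine integral_mono_ae (hM'.sub (hP.1 _ hM))
            (hh.indicator₀ (nullMeasurableSet_hopfMajorant_pos hP hh (n + 1))) ?_
          filter_upwards [hP.2.1 _ hM hM0] with x hx
          simp only [Pi.zero_apply] at hx
          by_cases hpos : 0 < hopfMajorant P h (n + 1) x
          · rw [Set.indicator_of_mem (by exact hpos)]
            have : hopfMajorant P h (n + 1) x = h x + P (hopfMajorant P h n) x :=
              max_eq_left (le_of_lt (by simpa [hopfMajorant] using hpos))
            linarith
          · rw [Set.indicator_of_notMem (by exact hpos)]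
            have := not_lt.1 hpos
            linarith

theorem mul_lintegral_hopfMajorant_le (hP : IsMarkovOperator m P) {g w : X → ℝ}
    (hg : Integrable g m) (hg0 : 0 ≤ᵐ[m] g) (hw : Integrable w m) (hw0 : 0 ≤ᵐ[m] w)
    (a n : ℕ) :
    a * ∫⁻ x, {x | 0 < hopfMajorant P (w - (a : ℝ) • g) n x}.indicator
      (fun x => ENNReal.ofReal (g x)) x ∂m ≤ ENNReal.ofReal (∫ x, w x ∂m) := by
  have hh : Integrable (w - (a : ℝ) • g) m := hw.sub (hg.smul _)
  set A := {x | 0 < hopfMajorant P (w - (a : ℝ) • g) n x}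
  have hA : NullMeasurableSet A m := nullMeasurableSet_hopfMajorant_pos hP hh n
  have hgA : Integrable (A.indicator g) m := hg.indicator₀ hA
  have hgA0 : 0 ≤ᵐ[m] A.indicator g := by
    filter_upwards [hg0] with x hx
    exact Set.indicator_apply_nonneg fun _ => hx
  have h1 : ∫⁻ x, A.indicator (fun x => ENNReal.ofReal (g x)) x ∂m =
      ENNReal.ofReal (∫ x, A.indicator g x ∂m) := by
    rw [ofReal_integral_eq_lintegral_ofReal hgA hgA0]
    refine lintegral_congr fun x => ?_
    by_cases hx : x ∈ A <;> simp [hx]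
  rw [h1, ← ENNReal.ofReal_natCast, ← ENNReal.ofReal_mul (Nat.cast_nonneg a)]
  refine ENNReal.ofReal_le_ofReal ?_
  have h2 := integral_indicator_hopfMajorant_nonneg hP hh n
  have h3 : ∫ x, A.indicator (w - (a : ℝ) • g) x ∂m ≤
      ∫ x, (w x - a * A.indicator g x) ∂m := by
    refine integral_mono_ae (hh.indicator₀ hA) (hw.sub (hgA.const_mul _)) ?_
    filter_upwards [hw0] with x hx
    by_cases hxA : x ∈ A
    · simp [hxA]
    · simpa [hxA] using hx
  rw [integral_sub hw (hgA.const_mul _), integral_const_mul] at h3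
  linarith

/-- If `∑ Pᵏ g` is finite a.e. for one strictly positive `g ∈ L¹`, then `∑ Pᵏ w` is finite a.e.
for every nonnegative `w ∈ L¹`. -/
theorem tsum_lt_top_of_tsum_lt_top (hP : IsMarkovOperator m P) {g w : X → ℝ}
    (hg : Integrable g m) (hgpos : ∀ᵐ x ∂m, 0 < g x) (hw : Integrable w m) (hw0 : 0 ≤ᵐ[m] w)
    (hsum : ∀ᵐ x ∂m, (∑' k : ℕ, ENNReal.ofReal ((P ^ k) g x)) < ⊤) :
    ∀ᵐ x ∂m, (∑' k : ℕ, ENNReal.ofReal ((P ^ k) w x)) < ⊤ := by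
  have hg0 : 0 ≤ᵐ[m] g := hgpos.mono fun x hx => hx.le
  let D : Set X := {x | (∑' k : ℕ, ENNReal.ofReal ((P ^ k) w x)) = ⊤}
  have hD : NullMeasurableSet D m := by
    have : AEMeasurable (fun x => ∑' k : ℕ, ENNReal.ofReal ((P ^ k) w x)) m :=
      AEMeasurable.tsum fun k => (hP.integrable_pow hw k).aemeasurable.ennreal_ofReal
    exact this.nullMeasurableSet_preimage (measurableSet_singleton ⊤)
  have hbound : ∀ a : ℕ, a * ∫⁻ x, D.indicator (fun x => ENNReal.ofReal (g x)) x ∂m ≤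
      ENNReal.ofReal (∫ x, w x ∂m) := by
    intro a
    have hh : Integrable (w - (a : ℝ) • g) m := hw.sub (hg.smul _)
    let F : ℕ → X → ℝ≥0∞ := fun n => {x | 0 < hopfMajorant P (w - (a : ℝ) • g) n x}.indicator
      (fun x => ENNReal.ofReal (g x))
    have hF : ∀ n, AEMeasurable (F n) m := fun n =>
      hg.aemeasurable.ennreal_ofReal.indicator₀ (nullMeasurableSet_hopfMajorant_pos hP hh n)
    have hDF : ∀ᵐ x ∂m, D.indicator (fun x => ENNReal.ofReal (g x)) x ≤
        liminf (fun n => F n x) atTop := by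
      filter_upwards [hsum, ae_all_iff.2 (hP.pow_nonneg hg hg0),
        ae_all_iff.2 (hP.pow_nonneg hw hw0),
        ae_all_iff.2 (partialSum_le_hopfMajorant hP hh)] with x hxg hg0 hw0 hxM
      by_cases hxD : x ∈ D
      swap
      · simp [hxD]
      rw [Set.indicator_of_mem hxD]
      refine le_liminf_of_le (by isBoundedDefault) ?_
      have hlim : Tendsto (fun n => ∑ k ∈ Finset.range n, ENNReal.ofReal ((P ^ k) w x)) atTop
          (𝓝 ⊤) := by
        have := ENNReal.tendsto_nat_tsum fun k => ENNReal.ofReal ((P ^ k) w x)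
        rwa [show _ = ⊤ from hxD] at this
      have hlt : a * (∑' k : ℕ, ENNReal.ofReal ((P ^ k) g x)) < ⊤ :=
        ENNReal.mul_lt_top (ENNReal.natCast_lt_top a) hxg
      filter_upwards [hlim.eventually (lt_mem_nhds hlt)] with n hn
      have hn' : a * (∑ k ∈ Finset.range n, ENNReal.ofReal ((P ^ k) g x)) <
          ∑ k ∈ Finset.range n, ENNReal.ofReal ((P ^ k) w x) :=
        lt_of_le_of_lt (by gcongr; apply ENNReal.sum_le_tsum) hn
      rw [← ENNReal.ofReal_sum_of_nonneg fun k _ => hg0 k,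
        ← ENNReal.ofReal_sum_of_nonneg fun k _ => hw0 k, ← ENNReal.ofReal_natCast,
        ← ENNReal.ofReal_mul (Nat.cast_nonneg a)] at hn'
      have hlt' := (ENNReal.ofReal_lt_ofReal_iff'.1 hn').1
      have hS : partialSum P (w - (a : ℝ) • g) n x =
          ∑ k ∈ Finset.range n, (P ^ k) w x - a * ∑ k ∈ Finset.range n, (P ^ k) g x := by
        simp [partialSum, Finset.sum_apply, Finset.sum_sub_distrib, Finset.mul_sum]
      have hmem : 0 < hopfMajorant P (w - (a : ℝ) • g) n x :=
        lt_of_lt_of_le (by rw [hS]; linarith) (hxM n)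
      simp [F, hmem]
    have hfatou := (lintegral_mono_ae hDF).trans (lintegral_liminf_le' hF)
    have hbd : ∀ n, a * ∫⁻ x, F n x ∂m ≤ ENNReal.ofReal (∫ x, w x ∂m) :=
      mul_lintegral_hopfMajorant_le hP hg hg0 hw hw0 a
    rcases Nat.eq_zero_or_pos a with rfl | ha
    · simp
    have ha0 : (a : ℝ≥0∞) ≠ 0 := by exact_mod_cast ha.ne'
    rw [mul_comm, ← ENNReal.le_div_iff_mul_le (Or.inl ha0) (Or.inl (ENNReal.natCast_ne_top a))]
    refine hfatou.trans (liminf_le_of_le (by isBoundedDefault) fun b hb => ?_)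
    obtain ⟨n, hn⟩ := hb.exists
    refine hn.trans ?_
    rw [ENNReal.le_div_iff_mul_le (Or.inl ha0) (Or.inl (ENNReal.natCast_ne_top a)), mul_comm]
    exact hbd n
  have hzero : ∫⁻ x, D.indicator (fun x => ENNReal.ofReal (g x)) x ∂m = 0 := by
    by_contra hne
    obtain ⟨a, ha⟩ := ENNReal.exists_nat_mul_gt hne (ENNReal.ofReal_ne_top (r := ∫ x, w x ∂m))
    exact absurd (hbound a) (not_le.2 ha)
  rw [lintegral_eq_zero_iff' (hg.aemeasurable.ennreal_ofReal.indicator₀ hD)] at hzero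
  filter_upwards [hzero, hgpos] with x hx hpos
  rw [lt_top_iff_ne_top]
  intro hxD
  rw [Set.indicator_of_mem (by exact hxD)] at hx
  simp only [Pi.zero_apply, ENNReal.ofReal_eq_zero] at hx
  linarith

end MaximalInequality

/-- If a properly subinvariant, a.e. positive measurable function `u` exists then `P` is
dissipative: for every `w ∈ L¹` with `w > 0` a.e., `∑ₖ (Pᵏ w)(x) < ∞` for a.e. `x`. -/
theorem dissipative_of_properlySubinvariant
    {X : Type*} [MeasurableSpace X] (m : Measure X) [SigmaFinite m]
    (P : (X → ℝ) →ₗ[ℝ] (X → ℝ)) (hP : IsMarkovOperator m P)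
    (u : X → ℝ≥0∞) (hu : Measurable u) (huPos : ∀ᵐ x ∂m, 0 < u x)
    (hsub : ProperlySubinvariant m P u) :
    ∀ w : X → ℝ, Integrable w m → (∀ᵐ x ∂m, 0 < w x) →
      ∀ᵐ x ∂m, (∑' k : ℕ, ENNReal.ofReal ((P ^ k) w x)) < ⊤ := by
  intro w hw hwpos
  obtain ⟨f, hf, hf0, -, hfu, Pu, hPu, hlt⟩ := hsub
  have hPum : AEMeasurable Pu m := aemeasurable_of_tendsto_metrizable_ae atTop
    (fun k => (hP.1 _ (hf k)).aemeasurable.ennreal_ofReal) hPu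
  let g : X → ℝ := fun x => (min (ENNReal.ofReal (w x)) (u x - Pu x)).toReal
  have hgval : ∀ x, ENNReal.ofReal (g x) = min (ENNReal.ofReal (w x)) (u x - Pu x) := fun x =>
    ENNReal.ofReal_toReal (ne_top_of_le_ne_top ENNReal.ofReal_ne_top (min_le_left _ _))
  have hg0 : ∀ x, 0 ≤ g x := fun x => ENNReal.toReal_nonneg
  have hgpos : ∀ᵐ x ∂m, 0 < g x := by
    filter_upwards [hwpos, hlt] with x hx hx'
    rw [← ENNReal.ofReal_pos, hgval]
    exact lt_min (ENNReal.ofReal_pos.2 hx) (tsub_pos_of_lt hx')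
  have hg : Integrable g m := by
    refine hw.mono' ((hw.aemeasurable.ennreal_ofReal.min
      (hu.aemeasurable.sub hPum)).ennreal_toReal.aestronglyMeasurable) ?_
    filter_upwards [hwpos] with x hx
    rw [Real.norm_of_nonneg (hg0 x)]
    exact ENNReal.toReal_le_of_le_ofReal hx.le (min_le_left _ _)
  have hgu : ∀ᵐ x ∂m, ENNReal.ofReal (g x) + Pu x ≤ u x := by
    filter_upwards [hlt] with x hx
    calc ENNReal.ofReal (g x) + Pu x ≤ (u x - Pu x) + Pu x := by
          rw [hgval]
          gcongr
          exact min_le_right _ _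
      _ = u x := tsub_add_cancel_of_le hx.le
  have hPS : ∀ n, (∀ᵐ x ∂m, ENNReal.ofReal (partialSum P g n x) ≤ u x) →
      ∀ᵐ x ∂m, ENNReal.ofReal (P (partialSum P g n) x) ≤ Pu x := fun n =>
    hP.ofReal_le_of_tendsto hf hf0 hfu hPu (integrable_partialSum hP hg n)
  have hS : ∀ n, ∀ᵐ x ∂m, ENNReal.ofReal (partialSum P g n x) ≤ u x := by
    intro n
    induction n with
    | zero => simp [partialSum]
    | succ n ih =>
      filter_upwards [hPS n ih, hgu] with x hx hx'
      rw [partialSum_succ]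
      exact (ENNReal.ofReal_add_le.trans (by gcongr)).trans hx'
  refine tsum_lt_top_of_tsum_lt_top hP hg hgpos hw (hwpos.mono fun x hx => hx.le) ?_
  filter_upwards [ae_all_iff.2 fun n => hPS n (hS n), hlt,
    ae_all_iff.2 (hP.pow_nonneg hg (Eventually.of_forall hg0))] with x hx hx' hpow
  refine lt_of_le_of_lt (b := ENNReal.ofReal (g x) + Pu x) ?_
    (ENNReal.add_lt_top.2 ⟨ENNReal.ofReal_lt_top, hx'.trans_le le_top⟩)
  refine ENNReal.tsum_le_of_sum_range_le fun n => ?_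
  refine (Finset.sum_le_sum_of_subset (Finset.range_mono n.le_succ)).trans ?_
  rw [← ENNReal.ofReal_sum_of_nonneg fun k _ => hpow k, ← Finset.sum_apply]
  change ENNReal.ofReal (partialSum P g (n + 1) x) ≤ _
  rw [partialSum_succ]
  exact ENNReal.ofReal_add_le.trans (by gcongr; exact hx n)
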